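/- Stability of Gaussian mean learning under change of prior: fix σ > 0, ξ > 0, ξ₂ > 0 and δ, δ₂ : ℝ. For every ε > 0 and every C > 0 there exists N : ℕ such that for all natural numbers n > N and all S : ℝ with |S| ≤ C·n, the Kullback–Leibler divergence of gaussianReal ((S·ξ² + δ·σ²)/(n·ξ² + σ²)) ((ξ²·σ²)/(n·ξ² + σ²)) from gaussianReal ((S·ξ₂² + δ₂·σ²)/(n·ξ₂² + σ²)) ((ξ₂²·σ²)/(n·ξ₂² + σ²)) is strictly less than ε. -/

import Mathlib

open MeasureTheory ProbabilityTheory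
open scoped NNReal ENNReal

/-- The Kullback–Leibler divergence `∫ log (dμ/dν) dμ` of `μ` from `ν`
(meaningful when `μ` is absolutely continuous with respect to `ν`). -/
noncomputable def klDiv {α : Type*} [MeasurableSpace α] (μ ν : Measure α) : ℝ :=
  ∫ x, Real.log ((μ.rnDeriv ν x).toReal) ∂μ

lemma rn_gauss (m₁ m₂ : ℝ) (v₁ v₂ : ℝ≥0) (h₁ : v₁ ≠ 0) (h₂ : v₂ ≠ 0) :
    ∀ᵐ x ∂(gaussianReal m₁ v₁),
      ((gaussianReal m₁ v₁).rnDeriv (gaussianReal m₂ v₂) x).toReal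
        = gaussianPDFReal m₁ v₁ x / gaussianPDFReal m₂ v₂ x := by
  have hac : gaussianReal m₁ v₁ ≪ gaussianReal m₂ v₂ :=
    (gaussianReal_absolutelyContinuous m₁ h₁).trans (gaussianReal_absolutelyContinuous' m₂ h₂)
  have h := Measure.rnDeriv_mul_rnDeriv (κ := (volume : Measure ℝ)) hac
  refine (gaussianReal_absolutelyContinuous m₁ h₁).ae_le ?_
  filter_upwards [h, rnDeriv_gaussianReal m₁ v₁, rnDeriv_gaussianReal m₂ v₂] with x hx hx1 hx2
  rw [Pi.mul_apply, hx1, hx2] at hx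
  have := congrArg ENNReal.toReal hx
  rw [ENNReal.toReal_mul, toReal_gaussianPDF, toReal_gaussianPDF] at this
  rw [eq_div_iff (gaussianPDFReal_pos m₂ v₂ x h₂).ne']
  exact this

lemma log_pdf (m : ℝ) (v : ℝ≥0) (h : v ≠ 0) (x : ℝ) :
    Real.log (gaussianPDFReal m v x)
      = -(Real.log (2 * Real.pi * v) / 2) - (x - m) ^ 2 / (2 * v) := by
  have hv : (0 : ℝ) < v := by positivity
  rw [gaussianPDFReal, Real.log_mul (by positivity) (by positivity), Real.log_exp, Real.log_inv,
    Real.log_sqrt (by positivity)]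
  ring

lemma integrable_sq_gauss (m : ℝ) (v : ℝ≥0) (c : ℝ) :
    Integrable (fun x => (x - c) ^ 2) (gaussianReal m v) := by
  have h : MemLp (fun x : ℝ => x - c) 2 (gaussianReal m v) :=
    (memLp_id_gaussianReal' 2 (by simp)).sub (memLp_const c)
  exact h.integrable_sq

lemma integral_sq_gauss (m : ℝ) (v : ℝ≥0) (c : ℝ) :
    ∫ x, (x - c) ^ 2 ∂(gaussianReal m v) = v + (m - c) ^ 2 := by
  have hvar : ∫ x, (x - m) ^ 2 ∂(gaussianReal m v) = v := by
    have := variance_fun_id_gaussianReal (μ := m) (v := v)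
    rw [variance_eq_integral measurable_id'.aemeasurable] at this
    simpa using this
  have hid : Integrable (fun x : ℝ => x) (gaussianReal m v) :=
    (memLp_id_gaussianReal' 1 (by simp)).integrable le_rfl
  have he : (fun x : ℝ => (x - c) ^ 2)
      = fun x => (x - m) ^ 2 + (2 * (m - c) * x + (c ^ 2 - m ^ 2)) := by
    funext x; ring
  have hlin : Integrable (fun x : ℝ => 2 * (m - c) * x + (c ^ 2 - m ^ 2)) (gaussianReal m v) :=
    (hid.const_mul _).add (integrable_const _)
  rw [he, integral_add (integrable_sq_gauss m v m) hlin,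
    integral_add (hid.const_mul _) (integrable_const _), integral_const_mul, hvar,
    integral_id_gaussianReal]
  simp
  ring

lemma klDiv_gauss (m₁ m₂ : ℝ) (v₁ v₂ : ℝ≥0) (h₁ : v₁ ≠ 0) (h₂ : v₂ ≠ 0) :
    klDiv (gaussianReal m₁ v₁) (gaussianReal m₂ v₂)
      = (Real.log (v₂ / v₁) + v₁ / v₂ - 1 + (m₁ - m₂) ^ 2 / v₂) / 2 := by
  have hv₁ : (0 : ℝ) < v₁ := by positivity
  have hv₂ : (0 : ℝ) < v₂ := by positivity
  have hπ := Real.pi_pos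
  have h : ∀ᵐ x ∂(gaussianReal m₁ v₁),
      Real.log (((gaussianReal m₁ v₁).rnDeriv (gaussianReal m₂ v₂) x).toReal)
        = (Real.log (v₂ / v₁) / 2 - (2 * v₁ : ℝ)⁻¹ * (x - m₁) ^ 2)
          + (2 * v₂ : ℝ)⁻¹ * (x - m₂) ^ 2 := by
    filter_upwards [rn_gauss m₁ m₂ v₁ v₂ h₁ h₂] with x hx
    rw [hx, Real.log_div (gaussianPDFReal_pos m₁ v₁ x h₁).ne' (gaussianPDFReal_pos m₂ v₂ x h₂).ne',
      log_pdf _ _ h₁, log_pdf _ _ h₂, Real.log_mul (by positivity) hv₁.ne',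
      Real.log_mul (by positivity) hv₂.ne', Real.log_div hv₂.ne' hv₁.ne']
    ring
  unfold klDiv
  rw [integral_congr_ae h, integral_add, integral_sub, integral_const_mul, integral_const_mul,
    integral_sq_gauss, integral_sq_gauss]
  · simp
    field_simp
    ring
  · exact integrable_const _
  · exact (integrable_sq_gauss _ _ _).const_mul _
  · exact (integrable_const _).sub ((integrable_sq_gauss _ _ _).const_mul _)
  · exact (integrable_sq_gauss _ _ _).const_mul _

lemma real_bound (a b s δ δ₂ C n S : ℝ) (ha : 0 < a) (hb : 0 < b) (hs : 0 < s) (hC : 0 < C)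
    (hn : 1 ≤ n) (hS : |S| ≤ C * n) :
    (Real.log ((b * s / (n * b + s)) / (a * s / (n * a + s)))
      + (a * s / (n * a + s)) / (b * s / (n * b + s)) - 1
      + ((S * a + δ * s) / (n * a + s) - (S * b + δ₂ * s) / (n * b + s)) ^ 2
        / (b * s / (n * b + s))) / 2
    ≤ (s ^ 2 * (b - a) ^ 2 / (a ^ 2 * b ^ 2)
      + (C * s * |a - b| + |δ| * s * (b + s) + |δ₂| * s * (a + s)) ^ 2 / (a ^ 2 * b ^ 2 * s)) / n := by
  have hn0 : 0 < n := by linarith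
  obtain ⟨A, hA⟩ : ∃ A, A = n * a + s := ⟨_, rfl⟩
  obtain ⟨B, hB⟩ : ∃ B, B = n * b + s := ⟨_, rfl⟩
  obtain ⟨K, hK⟩ : ∃ K, K = C * s * |a - b| + |δ| * s * (b + s) + |δ₂| * s * (a + s) := ⟨_, rfl⟩
  rw [← hA, ← hB, ← hK]
  have hAa : n * a ≤ A := by linarith
  have hBb : n * b ≤ B := by linarith
  have hna : 0 < n * a := by positivity
  have hnb : 0 < n * b := by positivity
  have hA0 : 0 < A := by linarith
  have hB0 : 0 < B := by linarith
  have hlog := Real.log_le_sub_one_of_pos (x := (b * s / B) / (a * s / A)) (by positivity)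
  have e1 : (b * s / B) / (a * s / A) - 1 + (a * s / A) / (b * s / B) - 1
      = s ^ 2 * (b - a) ^ 2 / (a * b * A * B) := by
    have : b * A - a * B = s * (b - a) := by rw [hA, hB]; ring
    rw [← mul_pow, ← this]
    field_simp
    ring
  have b1 : s ^ 2 * (b - a) ^ 2 / (a * b * A * B) ≤ s ^ 2 * (b - a) ^ 2 / (a ^ 2 * b ^ 2) / n := by
    rw [div_div]
    apply div_le_div_of_nonneg_left (by positivity) (by positivity)
    have : (n * a) * (n * b) ≤ A * B := mul_le_mul hAa hBb hnb.le hA0.le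
    calc a ^ 2 * b ^ 2 * n ≤ a ^ 2 * b ^ 2 * (n * n) := by gcongr; nlinarith
      _ = a * b * ((n * a) * (n * b)) := by ring
      _ ≤ a * b * (A * B) := by gcongr
      _ = _ := by ring
  have e2 : ((S * a + δ * s) / A - (S * b + δ₂ * s) / B) ^ 2 / (b * s / B)
      = (S * s * (a - b) + δ * s * B - δ₂ * s * A) ^ 2 / (A ^ 2 * B * b * s) := by
    have : S * s * (a - b) + δ * s * B - δ₂ * s * A
        = (S * a + δ * s) * B - (S * b + δ₂ * s) * A := by rw [hA, hB]; ring
    rw [this]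
    field_simp
  have hT : |S * s * (a - b) + δ * s * B - δ₂ * s * A| ≤ n * K := by
    have hB' : B ≤ n * (b + s) := by nlinarith
    have hA' : A ≤ n * (a + s) := by nlinarith
    calc |S * s * (a - b) + δ * s * B - δ₂ * s * A|
        ≤ |S * s * (a - b)| + |δ * s * B| + |δ₂ * s * A| :=
          (abs_sub _ _).trans (by gcongr; exact abs_add_le _ _)
      _ = |S| * s * |a - b| + |δ| * s * B + |δ₂| * s * A := by
          simp only [abs_mul, abs_of_pos hs, abs_of_pos hB0, abs_of_pos hA0]
      _ ≤ (C * n) * s * |a - b| + |δ| * s * (n * (b + s)) + |δ₂| * s * (n * (a + s)) := by gcongr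
      _ = n * K := by rw [hK]; ring
  have b2 : (S * s * (a - b) + δ * s * B - δ₂ * s * A) ^ 2 / (A ^ 2 * B * b * s)
      ≤ K ^ 2 / (a ^ 2 * b ^ 2 * s) / n := by
    calc _ ≤ (n * K) ^ 2 / ((n * a) ^ 2 * (n * b) * b * s) := by
          rw [← sq_abs (S * s * (a - b) + δ * s * B - δ₂ * s * A)]
          gcongr
      _ = _ := by field_simp
  have p1 : 0 ≤ s ^ 2 * (b - a) ^ 2 / (a ^ 2 * b ^ 2) / n := by positivity
  have p2 : 0 ≤ K ^ 2 / (a ^ 2 * b ^ 2 * s) / n := by positivity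
  rw [e2, add_div (s ^ 2 * (b - a) ^ 2 / (a ^ 2 * b ^ 2)) _ n]
  linarith

theorem gaussian_mean_learning_stability
    (σ ξ ξ₂ : ℝ≥0) (hσ : 0 < σ) (hξ : 0 < ξ) (hξ₂ : 0 < ξ₂) (δ δ₂ : ℝ) :
    ∀ ε : ℝ, 0 < ε → ∀ C : ℝ, 0 < C → ∃ N : ℕ, ∀ n : ℕ, N < n → ∀ S : ℝ, |S| ≤ C * n →
      klDiv
        (gaussianReal
          ((S * (ξ : ℝ) ^ 2 + δ * (σ : ℝ) ^ 2) / ((n : ℝ) * (ξ : ℝ) ^ 2 + (σ : ℝ) ^ 2))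
          ((ξ ^ 2 * σ ^ 2) / ((n : ℝ≥0) * ξ ^ 2 + σ ^ 2)))
        (gaussianReal
          ((S * (ξ₂ : ℝ) ^ 2 + δ₂ * (σ : ℝ) ^ 2) / ((n : ℝ) * (ξ₂ : ℝ) ^ 2 + (σ : ℝ) ^ 2))
          ((ξ₂ ^ 2 * σ ^ 2) / ((n : ℝ≥0) * ξ₂ ^ 2 + σ ^ 2))) < ε := by
  intro ε hε C hC
  obtain ⟨M, hM⟩ : ∃ M : ℝ, M = (((σ : ℝ) ^ 2) ^ 2 * ((ξ₂ : ℝ) ^ 2 - (ξ : ℝ) ^ 2) ^ 2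
      / (((ξ : ℝ) ^ 2) ^ 2 * ((ξ₂ : ℝ) ^ 2) ^ 2)
      + (C * (σ : ℝ) ^ 2 * |(ξ : ℝ) ^ 2 - (ξ₂ : ℝ) ^ 2| + |δ| * (σ : ℝ) ^ 2 * ((ξ₂ : ℝ) ^ 2 + (σ : ℝ) ^ 2)
        + |δ₂| * (σ : ℝ) ^ 2 * ((ξ : ℝ) ^ 2 + (σ : ℝ) ^ 2)) ^ 2
        / (((ξ : ℝ) ^ 2) ^ 2 * ((ξ₂ : ℝ) ^ 2) ^ 2 * (σ : ℝ) ^ 2)) := ⟨_, rfl⟩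
  obtain ⟨N, hN⟩ := exists_nat_gt (M / ε)
  refine ⟨N, fun n hn S hS => ?_⟩
  have hn1 : (1 : ℝ) ≤ n := by exact_mod_cast (by omega : 1 ≤ n)
  have hNn : (N : ℝ) < n := by exact_mod_cast hn
  have hσ' : (0 : ℝ) < σ := hσ
  have hξ' : (0 : ℝ) < ξ := hξ
  have hξ₂' : (0 : ℝ) < ξ₂ := hξ₂
  rw [klDiv_gauss _ _ _ _ (by positivity) (by positivity)]
  push_cast
  refine (real_bound ((ξ : ℝ) ^ 2) ((ξ₂ : ℝ) ^ 2) ((σ : ℝ) ^ 2) δ δ₂ C n S (by positivity)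
    (by positivity) (by positivity) hC hn1 hS).trans_lt ?_
  rw [← hM, div_lt_iff₀ (by linarith)]
  rw [div_lt_iff₀ hε] at hN
  nlinarith
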